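/- arXiv:2407.05859 — 5 statements merged into one kernel-verified Lean document; each statement's English description precedes it below -/
import Mathlib

section
/- Let X and Y be finitely generated free abelian groups, let ℓ : Y → ℝ be an injective additive group homomorphism, let f : X → Y be an additive group homomorphism, and let S be a finite subset of X not containing 0. Then there exists an additive group homomorphism j : X → ℝ such that for every s ∈ S one has j(s) ≠ 0, and moreover whenever j(s) > 0 one has ℓ(f(s)) ≥ 0. -/
open Filter Topology in
/-- A sufficiently small positive perturbation preserves strict signs, and makes zero values
nonzero. -/
lemma eventually_add_mul_ne_zero_and_nonneg (a : ℝ) {b : ℝ} (hb : b ≠ 0) :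
    ∀ᶠ ε in 𝓝[>] (0 : ℝ), a + ε * b ≠ 0 ∧ (0 < a + ε * b → 0 ≤ a) := by
  have hlim : Tendsto (fun ε : ℝ ↦ a + ε * b) (𝓝[>] 0) (𝓝 a) := by
    have hcont : Continuous fun ε : ℝ ↦ a + ε * b := by fun_prop
    simpa using (hcont.tendsto 0).mono_left nhdsWithin_le_nhds
  rcases lt_trichotomy a 0 with ha | rfl | ha
  · filter_upwards [hlim.eventually_lt_const ha] with ε hε
    exact ⟨hε.ne, fun h ↦ absurd h hε.not_gt⟩
  · filter_upwards [self_mem_nhdsWithin] with ε hε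
    simpa [hb] using ne_of_gt (Set.mem_Ioi.mp hε)
  · filter_upwards [hlim.eventually_const_lt ha] with ε hε
    exact ⟨hε.ne', fun _ ↦ ha.le⟩

/-- A finite set of nonzero elements of a free abelian group avoids the kernel of some
real-valued homomorphism. -/
lemma exists_addMonoidHom_real_forall_ne_zero {X : Type*} [AddCommGroup X] [Module.Free ℤ X]
    (S : Finset X) (hS : (0 : X) ∉ S) : ∃ g : X →+ ℝ, ∀ s ∈ S, g s ≠ 0 := by
  let b := Module.Free.chooseBasis ℤ X
  let φ : X →+ (Module.Free.ChooseBasisIndex ℤ X →₀ ℝ) :=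
    (Finsupp.mapRange.addMonoidHom (Int.castAddHom ℝ)).comp b.repr.toLinearMap.toAddMonoidHom
  have hφ : Function.Injective φ :=
    (Finsupp.mapRange_injective _ (map_zero (Int.castAddHom ℝ)) Int.cast_injective).comp
      b.repr.injective
  obtain ⟨g, hg⟩ := Module.exists_dual_forall_apply_ne_zero (K := ℝ) (fun s : S ↦ φ s)
    fun s ↦ (map_ne_zero_iff φ hφ).mpr (ne_of_mem_of_not_mem s.2 hS)
  exact ⟨g.toAddMonoidHom.comp φ, fun s hs ↦ hg ⟨s, hs⟩⟩


/-- Let `X` and `Y` be finitely generated free abelian groups, let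
`ℓ : Y → ℝ` be an injective additive group homomorphism, let `f : X → Y` be an additive
group homomorphism, and let `S` be a finite subset of `X` not containing `0`.  Then there
exists an additive group homomorphism `j : X → ℝ` such that for every `s ∈ S` one has
`j s ≠ 0`, and moreover whenever `j s > 0` one has `ℓ (f s) ≥ 0`. -/
theorem stmt_0 {X Y : Type*} [AddCommGroup X] [Module.Free ℤ X] [Module.Finite ℤ X]
    [AddCommGroup Y] [Module.Free ℤ Y] [Module.Finite ℤ Y]
    (ℓ : Y →+ ℝ) (hℓ : Function.Injective ℓ) (f : X →+ Y)
    (S : Finset X) (hS : (0 : X) ∉ S) :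
    ∃ j : X →+ ℝ, (∀ s ∈ S, j s ≠ 0) ∧ ∀ s ∈ S, 0 < j s → 0 ≤ ℓ (f s) := by
  obtain ⟨g, hg⟩ := exists_addMonoidHom_real_forall_ne_zero S hS
  obtain ⟨ε, hε⟩ := ((Filter.eventually_all_finset S).mpr fun s hs ↦
    eventually_add_mul_ne_zero_and_nonneg (ℓ (f s)) (hg s hs)).exists
  exact ⟨ℓ.comp f + (AddMonoidHom.mulLeft ε).comp g,
    fun s hs ↦ (hε s hs).1, fun s hs ↦ (hε s hs).2⟩
end

section
/- Set λ₁ = e₁, λ₂ = (e₁ + e₂ + e₃ + e₄)/2, λ₃ = (e₁ + e₂ + e₃ − e₄)/2, λ₄ = (e₁ + e₂ − e₃ + e₄)/2 in ℚ⁴. Then: (i) λ₄ ≺ λ₃ ≺ λ₂ ≺ λ₁ for the dominance order; (ii) every element w of the weight multiset W other than λ₁, λ₂, λ₃, λ₄ (including the zero weight) satisfies w ≺ λ₄; (iii) (λ₁, λ₂, λ₃, λ₄) is a ℤ-basis of the F₄ weight lattice X, i.e. every element of X is uniquely a ℤ-linear combination of λ₁, λ₂, λ₃, λ₄. -/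
/-- The four simple roots `α₁, α₂, α₃, α₄` of `F₄` in `ℚ⁴`:
`α₁ = e₂ - e₃`, `α₂ = e₃ - e₄`, `α₃ = e₄`, `α₄ = (e₁ - e₂ - e₃ - e₄)/2`. -/
def F4SimpleRoot : Fin 4 → (Fin 4 → ℚ) :=
  ![![0, 1, -1, 0], ![0, 0, 1, -1], ![0, 0, 0, 1], ![1/2, -1/2, -1/2, -1/2]]

/-- The `F₄` weight lattice: the subgroup of `ℚ⁴` generated by `e₁, e₂, e₃, e₄` and
`(e₁ + e₂ + e₃ + e₄)/2`. -/
def F4WeightLattice : AddSubgroup (Fin 4 → ℚ) :=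
  AddSubgroup.closure
    {![1,0,0,0], ![0,1,0,0], ![0,0,1,0], ![0,0,0,1], ![1/2,1/2,1/2,1/2]}

/-- The weight multiset `W` of the 26-dimensional irreducible representation of `F₄`:
the zero weight twice, `±e₁, …, ±e₄`, and the sixteen vectors `(±e₁ ± e₂ ± e₃ ± e₄)/2`. -/
def F4WeightMultiset : Multiset (Fin 4 → ℚ) :=
  ↑[(0 : Fin 4 → ℚ), 0,
    ![1,0,0,0], ![-1,0,0,0], ![0,1,0,0], ![0,-1,0,0],
    ![0,0,1,0], ![0,0,-1,0], ![0,0,0,1], ![0,0,0,-1],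
    ![1/2,1/2,1/2,1/2], ![1/2,1/2,1/2,-1/2], ![1/2,1/2,-1/2,1/2], ![1/2,1/2,-1/2,-1/2],
    ![1/2,-1/2,1/2,1/2], ![1/2,-1/2,1/2,-1/2], ![1/2,-1/2,-1/2,1/2], ![1/2,-1/2,-1/2,-1/2],
    ![-1/2,1/2,1/2,1/2], ![-1/2,1/2,1/2,-1/2], ![-1/2,1/2,-1/2,1/2], ![-1/2,1/2,-1/2,-1/2],
    ![-1/2,-1/2,1/2,1/2], ![-1/2,-1/2,1/2,-1/2], ![-1/2,-1/2,-1/2,1/2],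
    ![-1/2,-1/2,-1/2,-1/2]]

/-- The dominance order on weights: `μ ⪯ ν` iff `ν − μ` is a sum with nonnegative integer
coefficients of the simple roots `α₁, α₂, α₃, α₄`. -/
def F4DomLE (μ ν : Fin 4 → ℚ) : Prop :=
  ∃ n : Fin 4 → ℕ, ν - μ = ∑ i, (n i : ℚ) • F4SimpleRoot i

/-- The strict dominance order. -/
def F4DomLT (μ ν : Fin 4 → ℚ) : Prop := F4DomLE μ ν ∧ μ ≠ ν

/-- The coefficients of `ν - μ` on the simple roots are explicit linear forms in its coordinates,
so dominance amounts to these four forms taking natural number values. -/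
theorem F4DomLE.of_coeff {μ ν : Fin 4 → ℚ} (a b c d : ℕ)
    (ha : (ν - μ) 0 + (ν - μ) 1 = a)
    (hb : 2 * (ν - μ) 0 + (ν - μ) 1 + (ν - μ) 2 = b)
    (hc : 3 * (ν - μ) 0 + (ν - μ) 1 + (ν - μ) 2 + (ν - μ) 3 = c)
    (hd : 2 * (ν - μ) 0 = d) : F4DomLE μ ν := by
  refine ⟨![a, b, c, d], ?_⟩
  ext i
  fin_cases i <;> simp [Fin.sum_univ_four, F4SimpleRoot, ← ha, ← hb, ← hc, ← hd] <;> ring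

/-- The coordinates of an integral combination of `λ₁, λ₂, λ₃, λ₄`. -/
theorem eq_F4_combination_iff (x : Fin 4 → ℚ) (c : Fin 4 → ℤ) :
    x = c 0 • (![1,0,0,0] : Fin 4 → ℚ) + c 1 • ![1/2,1/2,1/2,1/2] +
          c 2 • ![1/2,1/2,1/2,-1/2] + c 3 • ![1/2,1/2,-1/2,1/2] ↔
      (c 0 : ℚ) = x 0 - x 1 ∧ (c 1 : ℚ) = x 2 + x 3 ∧
        (c 2 : ℚ) = x 1 - x 3 ∧ (c 3 : ℚ) = x 1 - x 2 := by
  constructor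
  · rintro rfl
    refine ⟨?_, ?_, ?_, ?_⟩ <;> simp <;> ring
  · rintro ⟨h0, h1, h2, h3⟩
    ext i
    fin_cases i <;> simp [h0, h1, h2, h3] <;> ring

/-- The coordinate forms dual to `λ₁, λ₂, λ₃, λ₄` are integral on the weight lattice. -/
theorem exists_int_of_mem_F4WeightLattice {x : Fin 4 → ℚ} (hx : x ∈ F4WeightLattice) :
    ∃ c : Fin 4 → ℤ, (c 0 : ℚ) = x 0 - x 1 ∧ (c 1 : ℚ) = x 2 + x 3 ∧
      (c 2 : ℚ) = x 1 - x 3 ∧ (c 3 : ℚ) = x 1 - x 2 := by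
  induction hx using AddSubgroup.closure_induction with
  | mem x hx =>
    simp only [Set.mem_insert_iff, Set.mem_singleton_iff] at hx
    rcases hx with rfl | rfl | rfl | rfl | rfl
    · exact ⟨![1, 0, 0, 0], by simp⟩
    · exact ⟨![-1, 0, 1, 1], by simp⟩
    · exact ⟨![0, 1, 0, -1], by simp⟩
    · exact ⟨![0, 1, -1, 0], by simp⟩
    · exact ⟨![0, 1, 0, 0], by simp; norm_num⟩
  | zero => exact ⟨0, by simp⟩
  | add x y _ _ hx hy =>
    obtain ⟨c, h0, h1, h2, h3⟩ := hx
    obtain ⟨d, k0, k1, k2, k3⟩ := hy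
    refine ⟨c + d, ?_, ?_, ?_, ?_⟩ <;> simp [*] <;> ring
  | neg x _ hx =>
    obtain ⟨c, h0, h1, h2, h3⟩ := hx
    refine ⟨-c, ?_, ?_, ?_, ?_⟩ <;> simp [*] <;> ring

/-- A weight of the 26-dimensional representation other than `λ₁, λ₂, λ₃` is dominated by `λ₄`. -/
theorem F4DomLE_of_mem_F4WeightMultiset {w : Fin 4 → ℚ} (hw : w ∈ F4WeightMultiset)
    (h1 : w ≠ ![1,0,0,0]) (h2 : w ≠ ![1/2,1/2,1/2,1/2]) (h3 : w ≠ ![1/2,1/2,1/2,-1/2]) :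
    F4DomLE w ![1/2,1/2,-1/2,1/2] := by
  simp only [F4WeightMultiset, Multiset.mem_coe, List.mem_cons, List.not_mem_nil, or_false] at hw
  have key : ∀ v : Fin 4 → ℚ, v = ![1/2,1/2,-1/2,1/2] - w →
      v 0 + v 1 = ⌊v 0 + v 1⌋₊ → 2 * v 0 + v 1 + v 2 = ⌊2 * v 0 + v 1 + v 2⌋₊ →
      3 * v 0 + v 1 + v 2 + v 3 = ⌊3 * v 0 + v 1 + v 2 + v 3⌋₊ → 2 * v 0 = ⌊2 * v 0⌋₊ →
      F4DomLE w ![1/2,1/2,-1/2,1/2] := by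
    rintro v rfl ha hb hc hd
    exact F4DomLE.of_coeff _ _ _ _ ha hb hc hd
  rcases hw with rfl | rfl | rfl | rfl | rfl | rfl | rfl | rfl | rfl | rfl | rfl | rfl | rfl |
    rfl | rfl | rfl | rfl | rfl | rfl | rfl | rfl | rfl | rfl | rfl | rfl | rfl <;>
  first
  | contradiction
  | refine key _ rfl ?_ ?_ ?_ ?_ <;> simp <;> norm_num

/-- With `λ₁ = e₁`, `λ₂ = (e₁+e₂+e₃+e₄)/2`, `λ₃ = (e₁+e₂+e₃−e₄)/2`,
`λ₄ = (e₁+e₂−e₃+e₄)/2`: (i) `λ₄ ≺ λ₃ ≺ λ₂ ≺ λ₁` in the dominance order; (ii) every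
element of the weight multiset `W` other than `λ₁, λ₂, λ₃, λ₄` satisfies `w ≺ λ₄`;
(iii) `(λ₁, λ₂, λ₃, λ₄)` is a `ℤ`-basis of the `F₄` weight lattice `X`, i.e. each `λᵢ`
lies in `X` and every element of `X` is uniquely a `ℤ`-linear combination of them. -/
theorem stmt_4 :
    (F4DomLT ![1/2,1/2,-1/2,1/2] ![1/2,1/2,1/2,-1/2] ∧
      F4DomLT ![1/2,1/2,1/2,-1/2] ![1/2,1/2,1/2,1/2] ∧
      F4DomLT ![1/2,1/2,1/2,1/2] ![1,0,0,0]) ∧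
    (∀ w ∈ F4WeightMultiset,
      w ≠ ![1,0,0,0] → w ≠ ![1/2,1/2,1/2,1/2] →
      w ≠ ![1/2,1/2,1/2,-1/2] → w ≠ ![1/2,1/2,-1/2,1/2] →
      F4DomLT w ![1/2,1/2,-1/2,1/2]) ∧
    ((![1,0,0,0] : Fin 4 → ℚ) ∈ F4WeightLattice ∧
      (![1/2,1/2,1/2,1/2] : Fin 4 → ℚ) ∈ F4WeightLattice ∧
      (![1/2,1/2,1/2,-1/2] : Fin 4 → ℚ) ∈ F4WeightLattice ∧
      (![1/2,1/2,-1/2,1/2] : Fin 4 → ℚ) ∈ F4WeightLattice) ∧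
    (∀ x ∈ F4WeightLattice, ∃! c : Fin 4 → ℤ,
      x = c 0 • (![1,0,0,0] : Fin 4 → ℚ) + c 1 • ![1/2,1/2,1/2,1/2] +
          c 2 • ![1/2,1/2,1/2,-1/2] + c 3 • ![1/2,1/2,-1/2,1/2]) := by
  refine ⟨⟨⟨?_, ?_⟩, ⟨?_, ?_⟩, ?_, ?_⟩, ?_, ⟨?_, ?_, ?_, ?_⟩, ?_⟩
  · refine F4DomLE.of_coeff 0 1 0 0 ?_ ?_ ?_ ?_ <;> simp
    norm_num
  · exact fun h => absurd (congrFun h 2) (by simp; try norm_num)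
  · refine F4DomLE.of_coeff 0 0 1 0 ?_ ?_ ?_ ?_ <;> simp
    norm_num
  · exact fun h => absurd (congrFun h 3) (by simp; try norm_num)
  · refine F4DomLE.of_coeff 0 0 0 1 ?_ ?_ ?_ ?_ <;> simp <;> norm_num
  · exact fun h => absurd (congrFun h 0) (by simp; try norm_num)
  · exact fun w hw h1 h2 h3 h4 => ⟨F4DomLE_of_mem_F4WeightMultiset hw h1 h2 h3, h4⟩
  · exact AddSubgroup.subset_closure (by simp)
  · exact AddSubgroup.subset_closure (by simp)
  · have h : (![1/2,1/2,1/2,-1/2] : Fin 4 → ℚ) = ![1/2,1/2,1/2,1/2] - ![0,0,0,1] := by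
      ext i; fin_cases i <;> norm_num
    rw [h]
    exact sub_mem (AddSubgroup.subset_closure (by simp)) (AddSubgroup.subset_closure (by simp))
  · have h : (![1/2,1/2,-1/2,1/2] : Fin 4 → ℚ) = ![1/2,1/2,1/2,1/2] - ![0,0,1,0] := by
      ext i; fin_cases i <;> norm_num
    rw [h]
    exact sub_mem (AddSubgroup.subset_closure (by simp)) (AddSubgroup.subset_closure (by simp))
  · intro x hx
    simp only [eq_F4_combination_iff]
    obtain ⟨c, hc⟩ := exists_int_of_mem_F4WeightLattice hx
    refine ⟨c, hc, fun d hd => ?_⟩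
    obtain ⟨c0, c1, c2, c3⟩ := hc
    obtain ⟨d0, d1, d2, d3⟩ := hd
    ext i
    apply Int.cast_injective (α := ℚ)
    fin_cases i
    exacts [d0.trans c0.symm, d1.trans c1.symm, d2.trans c2.symm, d3.trans c3.symm]
end

section
/- As an identity of complex numbers, (1/2⁴)·ζ(−1)·ζ(−5)·ζ(−7)·ζ(−11) = 691 / (2¹⁵·3⁶·5²·7²·13), and moreover 691 / (2¹⁵·3⁶·5²·7²·13) = 1/(2¹⁵·3⁶·5²·7) + 1/(2¹²·3⁵·7²·13). -/
theorem bernoulli'_six : bernoulli' 6 = 1 / 42 := by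
  rw [bernoulli'_def]
  norm_num [Finset.sum_range_succ, Nat.choose,
    bernoulli'_eq_zero_of_odd (n := 5) (by decide) (by norm_num)]

theorem bernoulli'_eight : bernoulli' 8 = -1 / 30 := by
  rw [bernoulli'_def]
  norm_num [Finset.sum_range_succ, Nat.choose,
    bernoulli'_eq_zero_of_odd (n := 5) (by decide) (by norm_num),
    bernoulli'_eq_zero_of_odd (n := 7) (by decide) (by norm_num),
    bernoulli'_six]

theorem bernoulli'_ten : bernoulli' 10 = 5 / 66 := by
  rw [bernoulli'_def]
  norm_num [Finset.sum_range_succ, Nat.choose,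
    bernoulli'_eq_zero_of_odd (n := 5) (by decide) (by norm_num),
    bernoulli'_eq_zero_of_odd (n := 7) (by decide) (by norm_num),
    bernoulli'_eq_zero_of_odd (n := 9) (by decide) (by norm_num),
    bernoulli'_six,
    bernoulli'_eight]

theorem bernoulli'_twelve : bernoulli' 12 = -691 / 2730 := by
  rw [bernoulli'_def]
  norm_num [Finset.sum_range_succ, Nat.choose,
    bernoulli'_eq_zero_of_odd (n := 5) (by decide) (by norm_num),
    bernoulli'_eq_zero_of_odd (n := 7) (by decide) (by norm_num),
    bernoulli'_eq_zero_of_odd (n := 9) (by decide) (by norm_num),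
    bernoulli'_eq_zero_of_odd (n := 11) (by decide) (by norm_num),
    bernoulli'_six,
    bernoulli'_eight,
    bernoulli'_ten]

/-- As an identity of complex numbers,
`(1/2⁴) ζ(−1) ζ(−5) ζ(−7) ζ(−11) = 691 / (2¹⁵·3⁶·5²·7²·13)`, and moreover
`691 / (2¹⁵·3⁶·5²·7²·13) = 1/(2¹⁵·3⁶·5²·7) + 1/(2¹²·3⁵·7²·13)`. -/
theorem stmt_8 :
    (1 / 2 ^ 4 : ℂ) * riemannZeta (-1) * riemannZeta (-5) * riemannZeta (-7) *
        riemannZeta (-11) =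
      691 / (2 ^ 15 * 3 ^ 6 * 5 ^ 2 * 7 ^ 2 * 13) ∧
    (691 / (2 ^ 15 * 3 ^ 6 * 5 ^ 2 * 7 ^ 2 * 13) : ℂ) =
      1 / (2 ^ 15 * 3 ^ 6 * 5 ^ 2 * 7) + 1 / (2 ^ 12 * 3 ^ 5 * 7 ^ 2 * 13) := by
  have h1 := riemannZeta_neg_nat_eq_bernoulli' 1
  have h5 := riemannZeta_neg_nat_eq_bernoulli' 5
  have h7 := riemannZeta_neg_nat_eq_bernoulli' 7
  have h11 := riemannZeta_neg_nat_eq_bernoulli' 11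
  norm_num [bernoulli'_six, bernoulli'_eight, bernoulli'_twelve] at h1 h5 h7 h11
  constructor
  · rw [h1, h5, h7, h11]
    norm_num
  · norm_num
end

section
/- Let A ∈ Sp(3) be a 3×3 quaternionic matrix in the compact symplectic group. Then A commutes with every matrix in SO(3) (regarded as a quaternionic matrix via ℝ ⊆ ℍ) if and only if A = h·1₃ for some quaternion h of norm 1, where 1₃ is the identity matrix. -/
open Matrix

/-- A matrix commuting with `diag(1, -1, -1)`, `diag(-1, -1, 1)` and a cyclic permutation matrix is
a scalar matrix. -/
lemma eq_diagonal_of_commute_rotations (A : Matrix (Fin 3) (Fin 3) (Quaternion ℝ))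
    (hA : ∀ O : Matrix (Fin 3) (Fin 3) ℝ, Oᵀ * O = 1 → O.det = 1 →
      A * O.map (algebraMap ℝ (Quaternion ℝ)) = O.map (algebraMap ℝ (Quaternion ℝ)) * A) :
    A = Matrix.diagonal fun _ => A 0 0 := by
  have : IsAddTorsionFree (Quaternion ℝ) := .of_module_rat _
  have hx := hA !![1, 0, 0; 0, -1, 0; 0, 0, -1]
    (by ext i j; fin_cases i <;> fin_cases j <;> simp [Matrix.mul_apply, Fin.sum_univ_three])
    (by simp [Matrix.det_fin_three])
  have hz := hA !![-1, 0, 0; 0, -1, 0; 0, 0, 1]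
    (by ext i j; fin_cases i <;> fin_cases j <;> simp [Matrix.mul_apply, Fin.sum_univ_three])
    (by simp [Matrix.det_fin_three])
  have hp := hA !![0, 1, 0; 0, 0, 1; 1, 0, 0]
    (by ext i j; fin_cases i <;> fin_cases j <;> simp [Matrix.mul_apply, Fin.sum_univ_three])
    (by simp [Matrix.det_fin_three])
  have hx' := fun i j => congrFun (congrFun hx i) j
  have hz' := fun i j => congrFun (congrFun hz i) j
  have hp' := fun i j => congrFun (congrFun hp i) j
  simp only [Matrix.mul_apply, Fin.sum_univ_three, Matrix.map_apply] at hx' hz' hp'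
  have h01 : A 0 1 = 0 := by simpa [neg_eq_self] using hx' 0 1
  have h02 : A 0 2 = 0 := by simpa [neg_eq_self] using hx' 0 2
  have h10 : A 1 0 = 0 := by simpa [self_eq_neg] using hx' 1 0
  have h20 : A 2 0 = 0 := by simpa [self_eq_neg] using hx' 2 0
  have h12 : A 1 2 = 0 := by simpa [self_eq_neg] using hz' 1 2
  have h21 : A 2 1 = 0 := by simpa [neg_eq_self] using hz' 2 1
  have h11 : A 1 1 = A 0 0 := by simpa using (hp' 0 1).symm
  have h22 : A 2 2 = A 0 0 := by simpa using hp' 2 0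
  ext1 i j
  fin_cases i <;> fin_cases j <;> simp [h01, h02, h10, h20, h12, h21, h11, h22]

/-- Let `A` be a 3×3 quaternionic matrix in the compact symplectic group
`Sp(3)`, i.e. `Aᴴ * A = 1`.  Then `A` commutes with every matrix of `SO(3)` (regarded as
quaternionic via `ℝ ⊆ ℍ`) if and only if `A = h • 1₃` for some quaternion `h` of norm `1`. -/
theorem stmt_9 (A : Matrix (Fin 3) (Fin 3) (Quaternion ℝ)) (hA : Aᴴ * A = 1) :
    (∀ O : Matrix (Fin 3) (Fin 3) ℝ, Oᵀ * O = 1 → O.det = 1 →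
        A * O.map (algebraMap ℝ (Quaternion ℝ)) = O.map (algebraMap ℝ (Quaternion ℝ)) * A) ↔
      ∃ h : Quaternion ℝ, h * star h = 1 ∧ A = Matrix.diagonal fun _ => h := by
  constructor
  · intro hO
    have hd := eq_diagonal_of_commute_rotations A hO
    refine ⟨A 0 0, ?_, hd⟩
    rw [hd, Matrix.diagonal_conjTranspose, Matrix.diagonal_mul_diagonal] at hA
    have h00 := congrFun (congrFun hA 0) 0
    rw [← star_comm_self']
    simpa using h00
  · rintro ⟨h, -, rfl⟩ O - -
    ext1 i j
    rw [Matrix.diagonal_mul, Matrix.mul_diagonal, Matrix.map_apply]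
    exact (Algebra.commutes _ _).symm
end

section
/- The quadruples (w₁, w₂, w₃, w₄) of positive integers with w₁ > w₂ > w₃ > w₄ for which the 26-element multiset of rational numbers {0, 0} ∪ {±w₁/2, ±w₂/2, ±w₃/2, ±w₄/2} ∪ {(±w₁ ± w₂ ± w₃ ± w₄)/4 : all 16 sign choices} equals the multiset {0, 0, ±2, ±3, ±4, ±5, ±6, ±7, ±9, ±9, ±12, ±13, ±16, ±18} are exactly (26, 24, 18, 4), (32, 18, 12, 10) and (36, 14, 8, 6). -/
/-- Four times the left-hand multiset, for integer weights. -/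
def scaledWeights (a b c d : ℤ) : Multiset ℤ :=
  ({0, 0, 2 * a, -(2 * a), 2 * b, -(2 * b), 2 * c, -(2 * c), 2 * d, -(2 * d)} : Multiset ℤ) +
    (Finset.univ : Finset (Fin 4 → Bool)).val.map (fun ε =>
      (if ε 0 then a else -a) + (if ε 1 then b else -b) +
        (if ε 2 then c else -c) + (if ε 3 then d else -d))

/-- Four times the right-hand multiset. -/
def scaledEigenvalues : Multiset ℤ :=
  {0, 0, 8, -8, 12, -12, 16, -16, 20, -20, 24, -24, 28, -28, 36, -36, 36, -36, 48, -48, 52, -52,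
    64, -64, 72, -72}

/-- The integers `w` whose double is a positive element of `scaledEigenvalues`. -/
def weightCandidates : List ℤ := [4, 6, 8, 10, 12, 14, 18, 24, 26, 32, 36]

theorem mem_weightCandidates {w : ℤ} (hw : 0 < w) (h : 2 * w ∈ scaledEigenvalues) :
    w ∈ weightCandidates := by
  simp only [scaledEigenvalues, Multiset.insert_eq_cons, Multiset.mem_cons,
    Multiset.mem_singleton] at h
  simp only [weightCandidates, List.mem_cons, List.not_mem_nil, or_false]
  omega

theorem scaledWeights_eq_iff_of_mem : ∀ a ∈ weightCandidates, ∀ b ∈ weightCandidates, b < a →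
    ∀ c ∈ weightCandidates, c < b → ∀ d ∈ weightCandidates, d < c →
    (scaledWeights a b c d = scaledEigenvalues ↔
      ((a = 26 ∧ b = 24 ∧ c = 18 ∧ d = 4) ∨ (a = 32 ∧ b = 18 ∧ c = 12 ∧ d = 10) ∨
        (a = 36 ∧ b = 14 ∧ c = 8 ∧ d = 6))) := by
  decide +kernel

theorem scaledWeights_eq_iff {a b c d : ℤ} (hd : 0 < d) (hdc : d < c) (hcb : c < b)
    (hba : b < a) :
    scaledWeights a b c d = scaledEigenvalues ↔
      ((a = 26 ∧ b = 24 ∧ c = 18 ∧ d = 4) ∨ (a = 32 ∧ b = 18 ∧ c = 12 ∧ d = 10) ∨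
        (a = 36 ∧ b = 14 ∧ c = 8 ∧ d = 6)) := by
  constructor
  · intro h
    have ha : 2 * a ∈ scaledEigenvalues := h ▸ by simp [scaledWeights]
    have hb : 2 * b ∈ scaledEigenvalues := h ▸ by simp [scaledWeights]
    have hc : 2 * c ∈ scaledEigenvalues := h ▸ by simp [scaledWeights]
    have hd' : 2 * d ∈ scaledEigenvalues := h ▸ by simp [scaledWeights]
    exact (scaledWeights_eq_iff_of_mem a (mem_weightCandidates (by omega) ha)
      b (mem_weightCandidates (by omega) hb) hba c (mem_weightCandidates (by omega) hc) hcb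
      d (mem_weightCandidates hd hd') hdc).1 h
  · rintro (⟨rfl, rfl, rfl, rfl⟩ | ⟨rfl, rfl, rfl, rfl⟩ | ⟨rfl, rfl, rfl, rfl⟩) <;>
      decide +kernel

theorem intCast_div_four_injective : Function.Injective (fun n : ℤ => (n : ℚ) / 4) := by
  intro m n h
  have h' : (m : ℚ) = n := by simpa using h
  exact_mod_cast h'

theorem map_scaledWeights (a b c d : ℤ) :
    (scaledWeights a b c d).map (fun n : ℤ => (n : ℚ) / 4) =
      ({0, 0, (a:ℚ)/2, -((a:ℚ)/2), (b:ℚ)/2, -((b:ℚ)/2), (c:ℚ)/2, -((c:ℚ)/2),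
          (d:ℚ)/2, -((d:ℚ)/2)} : Multiset ℚ) +
        (Finset.univ : Finset (Fin 4 → Bool)).val.map (fun ε =>
          ((if ε 0 then (a:ℚ) else -(a:ℚ)) + (if ε 1 then (b:ℚ) else -(b:ℚ)) +
            (if ε 2 then (c:ℚ) else -(c:ℚ)) + (if ε 3 then (d:ℚ) else -(d:ℚ))) / 4) := by
  have half (x : ℤ) : ((2 * x : ℤ) : ℚ) / 4 = (x : ℚ) / 2 := by push_cast; ring
  have neg_half (x : ℤ) : ((-(2 * x) : ℤ) : ℚ) / 4 = -((x : ℚ) / 2) := by push_cast; ring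
  simp only [scaledWeights, Multiset.map_add, Multiset.map_map, Multiset.insert_eq_cons,
    Multiset.map_cons, Multiset.map_singleton, half, neg_half, Int.cast_zero, zero_div]
  congr 1
  refine Multiset.map_congr rfl fun ε _ => ?_
  simp only [Function.comp_apply]
  push_cast
  rfl

theorem map_scaledEigenvalues :
    scaledEigenvalues.map (fun n : ℤ => (n : ℚ) / 4) =
      ({0, 0, 2, -2, 3, -3, 4, -4, 5, -5, 6, -6, 7, -7, 9, -9, 9, -9, 12, -12, 13, -13,
          16, -16, 18, -18} : Multiset ℚ) := by
  simp only [scaledEigenvalues, Multiset.insert_eq_cons, Multiset.map_cons,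
    Multiset.map_singleton]
  norm_num


/-- The quadruples `(w₁, w₂, w₃, w₄)` of positive integers with
`w₁ > w₂ > w₃ > w₄` for which the 26-element multiset of rational numbers
`{0, 0} ∪ {±w₁/2, ±w₂/2, ±w₃/2, ±w₄/2} ∪ {(±w₁ ± w₂ ± w₃ ± w₄)/4 : all 16 sign choices}`
equals `{0, 0, ±2, ±3, ±4, ±5, ±6, ±7, ±9, ±9, ±12, ±13, ±16, ±18}` are exactly
`(26, 24, 18, 4)`, `(32, 18, 12, 10)` and `(36, 14, 8, 6)`. -/
theorem stmt_11 (w₁ w₂ w₃ w₄ : ℕ) (h₄ : 0 < w₄) (h₄₃ : w₄ < w₃) (h₃₂ : w₃ < w₂)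
    (h₂₁ : w₂ < w₁) :
    (({0, 0, (w₁:ℚ)/2, -((w₁:ℚ)/2), (w₂:ℚ)/2, -((w₂:ℚ)/2), (w₃:ℚ)/2, -((w₃:ℚ)/2),
          (w₄:ℚ)/2, -((w₄:ℚ)/2)} : Multiset ℚ) +
        (Finset.univ : Finset (Fin 4 → Bool)).val.map (fun ε =>
          ((if ε 0 then (w₁:ℚ) else -(w₁:ℚ)) + (if ε 1 then (w₂:ℚ) else -(w₂:ℚ)) +
            (if ε 2 then (w₃:ℚ) else -(w₃:ℚ)) + (if ε 3 then (w₄:ℚ) else -(w₄:ℚ))) / 4) =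
      ({0, 0, 2, -2, 3, -3, 4, -4, 5, -5, 6, -6, 7, -7, 9, -9, 9, -9, 12, -12, 13, -13,
          16, -16, 18, -18} : Multiset ℚ)) ↔
      ((w₁ = 26 ∧ w₂ = 24 ∧ w₃ = 18 ∧ w₄ = 4) ∨
        (w₁ = 32 ∧ w₂ = 18 ∧ w₃ = 12 ∧ w₄ = 10) ∨
        (w₁ = 36 ∧ w₂ = 14 ∧ w₃ = 8 ∧ w₄ = 6)) := by
  have key := map_scaledWeights w₁ w₂ w₃ w₄
  simp only [Int.cast_natCast] at key
  rw [← key, ← map_scaledEigenvalues, (Multiset.map_injective intCast_div_four_injective).eq_iff,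
    scaledWeights_eq_iff (by omega) (by omega) (by omega) (by omega)]
  omega
end
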